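/- arXiv:1005.2897 — 6 statements merged into one kernel-verified Lean document; each statement's English description precedes it below -/
import Mathlib

section
/- The rewrite relation →a of the call-by-name algebraic λ-calculus with algebraic reduction is AC-strongly-normalising: for every term M there exists n ∈ ℕ such that every →a-rewrite sequence starting from M contains at most n steps performed by a rule other than associativity or commutativity of +. -/
namespace AlgLam

/-- Terms of the algebraic λ-calculus over a ring of scalars `R`,
    in de Bruijn representation. -/
inductive Term (R : Type u) : Type u
  | var : ℕ → Term R
  | lam : Term R → Term R
  | app : Term R → Term R → Term R
  | zero : Term R
  | smul : R → Term R → Term R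
  | add : Term R → Term R → Term R

namespace Term

variable {R : Type u}

/-- De Bruijn lifting: shift the free indices `≥ d` up by one. -/
def lift (d : ℕ) : Term R → Term R
  | var n => if n < d then var n else var (n + 1)
  | lam M => lam (lift (d + 1) M)
  | app M N => app (lift d M) (lift d N)
  | zero => zero
  | smul a M => smul a (lift d M)
  | add M N => add (lift d M) (lift d N)

/-- Capture-avoiding substitution of `N` for the free de Bruijn index `d`. -/
def subst (d : ℕ) (N : Term R) : Term R → Term R
  | var n => if n < d then var n else if n = d then N else var (n - 1)
  | lam M => lam (subst (d + 1) (lift 0 N) M)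
  | app M L => app (subst d N M) (subst d N L)
  | zero => zero
  | smul a M => smul a (subst d N M)
  | add M L => add (subst d N M) (subst d N L)

/-- Base terms: variables and λ-abstractions. -/
inductive IsBase : Term R → Prop
  | var (n : ℕ) : IsBase (var n)
  | lam (M : Term R) : IsBase (lam M)

/-- Values: `0`, base terms, scalar multiples of values, sums of values. -/
inductive IsValue : Term R → Prop
  | zero : IsValue zero
  | base {B : Term R} : IsBase B → IsValue B
  | smul (a : R) {V : Term R} : IsValue V → IsValue (smul a V)
  | add {V W : Term R} : IsValue V → IsValue W → IsValue (add V W)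

/-- `ClosedUnder d M` : every free index of `M` is `< d`. -/
def ClosedUnder : ℕ → Term R → Prop
  | d, var n => n < d
  | d, lam M => ClosedUnder (d + 1) M
  | d, app M N => ClosedUnder d M ∧ ClosedUnder d N
  | _, zero => True
  | d, smul _ M => ClosedUnder d M
  | d, add M N => ClosedUnder d M ∧ ClosedUnder d N

/-- A closed term (a program). -/
def Closed (M : Term R) : Prop := ClosedUnder 0 M

section Rules

variable [CommRing R]

/-- The rewrite relation `→a` of the call-by-name algebraic λ-calculus:
    ring rules and call-by-name application rules, closed under the ξ contexts. -/
inductive StepA : Term R → Term R → Prop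
  -- ring rules
  | assocL (M N L : Term R) : StepA (add M (add N L)) (add (add M N) L)
  | assocR (M N L : Term R) : StepA (add (add M N) L) (add M (add N L))
  | comm (M N : Term R) : StepA (add M N) (add N M)
  | factor (a b : R) (M : Term R) : StepA (add (smul a M) (smul b M)) (smul (a + b) M)
  | factor1 (a : R) (M : Term R) : StepA (add (smul a M) M) (smul (a + 1) M)
  | factor11 (M : Term R) : StepA (add M M) (smul (1 + 1) M)
  | mulMul (a b : R) (M : Term R) : StepA (smul a (smul b M)) (smul (a * b) M)
  | mulDist (a : R) (M N : Term R) : StepA (smul a (add M N)) (add (smul a M) (smul a N))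
  | oneSmul (M : Term R) : StepA (smul 1 M) M
  | zeroSmul (M : Term R) : StepA (smul 0 M) zero
  | smulZero (a : R) : StepA (smul a zero) zero
  | zeroAdd (M : Term R) : StepA (add zero M) M
  -- call-by-name application rules (A)
  | appAdd (M N L : Term R) : StepA (app (add M N) L) (add (app M L) (app N L))
  | appSmul (a : R) (M N : Term R) : StepA (app (smul a M) N) (smul a (app M N))
  | appZero (M : Term R) : StepA (app zero M) zero
  -- ξ context rules
  | ctxAppL {M M' : Term R} (N : Term R) : StepA M M' → StepA (app M N) (app M' N)
  | ctxAddL {M M' : Term R} (N : Term R) : StepA M M' → StepA (add M N) (add M' N)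
  | ctxAddR {N N' : Term R} (M : Term R) : StepA N N' → StepA (add M N) (add M N')
  | ctxSmul (a : R) {M M' : Term R} : StepA M M' → StepA (smul a M) (smul a M')

/-- The call-by-name β-reduction `→βn`, closed under the ξ contexts. -/
inductive StepBn : Term R → Term R → Prop
  | beta (M N : Term R) : StepBn (app (lam M) N) (subst 0 N M)
  | ctxAppL {M M' : Term R} (N : Term R) : StepBn M M' → StepBn (app M N) (app M' N)
  | ctxAddL {M M' : Term R} (N : Term R) : StepBn M M' → StepBn (add M N) (add M' N)
  | ctxAddR {N N' : Term R} (M : Term R) : StepBn N N' → StepBn (add M N) (add M N')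
  | ctxSmul (a : R) {M M' : Term R} : StepBn M M' → StepBn (smul a M) (smul a M')

/-- The rewrite relation `→a∪β`. -/
def StepAB (M N : Term R) : Prop := StepA M N ∨ StepBn M N

/-- The rewrite relation `→ℓ` of the call-by-value algebraic λ-calculus:
    ring rules, left- and right-linearity rules, closed under ξ and ξ_lin. -/
inductive StepL : Term R → Term R → Prop
  -- ring rules
  | assocL (M N L : Term R) : StepL (add M (add N L)) (add (add M N) L)
  | assocR (M N L : Term R) : StepL (add (add M N) L) (add M (add N L))
  | comm (M N : Term R) : StepL (add M N) (add N M)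
  | factor (a b : R) (M : Term R) : StepL (add (smul a M) (smul b M)) (smul (a + b) M)
  | factor1 (a : R) (M : Term R) : StepL (add (smul a M) M) (smul (a + 1) M)
  | factor11 (M : Term R) : StepL (add M M) (smul (1 + 1) M)
  | mulMul (a b : R) (M : Term R) : StepL (smul a (smul b M)) (smul (a * b) M)
  | mulDist (a : R) (M N : Term R) : StepL (smul a (add M N)) (add (smul a M) (smul a N))
  | oneSmul (M : Term R) : StepL (smul 1 M) M
  | zeroSmul (M : Term R) : StepL (smul 0 M) zero
  | smulZero (a : R) : StepL (smul a zero) zero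
  | zeroAdd (M : Term R) : StepL (add zero M) M
  -- left linearity (A_l), the argument must be a value
  | appAddV {V : Term R} (M N : Term R) : IsValue V →
      StepL (app (add M N) V) (add (app M V) (app N V))
  | appSmulV {V : Term R} (a : R) (M : Term R) : IsValue V →
      StepL (app (smul a M) V) (smul a (app M V))
  | appZeroV {V : Term R} : IsValue V → StepL (app zero V) zero
  -- right linearity (A_r), the function must be a base term
  | appAddB {B : Term R} (M N : Term R) : IsBase B →
      StepL (app B (add M N)) (add (app B M) (app B N))
  | appSmulB {B : Term R} (a : R) (M : Term R) : IsBase B →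
      StepL (app B (smul a M)) (smul a (app B M))
  | appZeroB {B : Term R} : IsBase B → StepL (app B zero) zero
  -- ξ context rules
  | ctxAppL {M M' : Term R} (N : Term R) : StepL M M' → StepL (app M N) (app M' N)
  | ctxAddL {M M' : Term R} (N : Term R) : StepL M M' → StepL (add M N) (add M' N)
  | ctxAddR {N N' : Term R} (M : Term R) : StepL N N' → StepL (add M N) (add M N')
  | ctxSmul (a : R) {M M' : Term R} : StepL M M' → StepL (smul a M) (smul a M')
  -- ξ_lin context rule
  | ctxAppR {V M M' : Term R} : IsValue V → StepL M M' → StepL (app V M) (app V M')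

/-- The call-by-value β-reduction `→βv`, closed under ξ and ξ_lin. -/
inductive StepBv : Term R → Term R → Prop
  | beta (M : Term R) {B : Term R} : IsBase B → StepBv (app (lam M) B) (subst 0 B M)
  | ctxAppL {M M' : Term R} (N : Term R) : StepBv M M' → StepBv (app M N) (app M' N)
  | ctxAddL {M M' : Term R} (N : Term R) : StepBv M M' → StepBv (add M N) (add M' N)
  | ctxAddR {N N' : Term R} (M : Term R) : StepBv N N' → StepBv (add M N) (add M N')
  | ctxSmul (a : R) {M M' : Term R} : StepBv M M' → StepBv (smul a M) (smul a M')
  | ctxAppR {V M M' : Term R} : IsValue V → StepBv M M' → StepBv (app V M) (app V M')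

/-- The rewrite relation `→ℓ∪β`. -/
def StepLB (M N : Term R) : Prop := StepL M N ∨ StepBv M N

end Rules

/-- Steps of `→a` performed by an associativity or commutativity rule
    (closed under the ξ contexts). -/
inductive StepACa : Term R → Term R → Prop
  | assocL (M N L : Term R) : StepACa (add M (add N L)) (add (add M N) L)
  | assocR (M N L : Term R) : StepACa (add (add M N) L) (add M (add N L))
  | comm (M N : Term R) : StepACa (add M N) (add N M)
  | ctxAppL {M M' : Term R} (N : Term R) : StepACa M M' → StepACa (app M N) (app M' N)
  | ctxAddL {M M' : Term R} (N : Term R) : StepACa M M' → StepACa (add M N) (add M' N)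
  | ctxAddR {N N' : Term R} (M : Term R) : StepACa N N' → StepACa (add M N) (add M N')
  | ctxSmul (a : R) {M M' : Term R} : StepACa M M' → StepACa (smul a M) (smul a M')

/-- Steps of `→ℓ` performed by an associativity or commutativity rule
    (closed under the ξ and ξ_lin contexts). -/
inductive StepACl : Term R → Term R → Prop
  | assocL (M N L : Term R) : StepACl (add M (add N L)) (add (add M N) L)
  | assocR (M N L : Term R) : StepACl (add (add M N) L) (add M (add N L))
  | comm (M N : Term R) : StepACl (add M N) (add N M)
  | ctxAppL {M M' : Term R} (N : Term R) : StepACl M M' → StepACl (app M N) (app M' N)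
  | ctxAddL {M M' : Term R} (N : Term R) : StepACl M M' → StepACl (add M N) (add M' N)
  | ctxAddR {N N' : Term R} (M : Term R) : StepACl N N' → StepACl (add M N) (add M N')
  | ctxSmul (a : R) {M M' : Term R} : StepACl M M' → StepACl (smul a M) (smul a M')
  | ctxAppR {V M M' : Term R} : IsValue V → StepACl M M' → StepACl (app V M) (app V M')

section NonAC

variable [CommRing R]

/-- Steps of `→a` performed by a rule other than associativity or commutativity of `+`
    (closed under the ξ contexts). -/
inductive StepNAa : Term R → Term R → Prop
  | factor (a b : R) (M : Term R) : StepNAa (add (smul a M) (smul b M)) (smul (a + b) M)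
  | factor1 (a : R) (M : Term R) : StepNAa (add (smul a M) M) (smul (a + 1) M)
  | factor11 (M : Term R) : StepNAa (add M M) (smul (1 + 1) M)
  | mulMul (a b : R) (M : Term R) : StepNAa (smul a (smul b M)) (smul (a * b) M)
  | mulDist (a : R) (M N : Term R) : StepNAa (smul a (add M N)) (add (smul a M) (smul a N))
  | oneSmul (M : Term R) : StepNAa (smul 1 M) M
  | zeroSmul (M : Term R) : StepNAa (smul 0 M) zero
  | smulZero (a : R) : StepNAa (smul a zero) zero
  | zeroAdd (M : Term R) : StepNAa (add zero M) M
  | appAdd (M N L : Term R) : StepNAa (app (add M N) L) (add (app M L) (app N L))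
  | appSmul (a : R) (M N : Term R) : StepNAa (app (smul a M) N) (smul a (app M N))
  | appZero (M : Term R) : StepNAa (app zero M) zero
  | ctxAppL {M M' : Term R} (N : Term R) : StepNAa M M' → StepNAa (app M N) (app M' N)
  | ctxAddL {M M' : Term R} (N : Term R) : StepNAa M M' → StepNAa (add M N) (add M' N)
  | ctxAddR {N N' : Term R} (M : Term R) : StepNAa N N' → StepNAa (add M N) (add M N')
  | ctxSmul (a : R) {M M' : Term R} : StepNAa M M' → StepNAa (smul a M) (smul a M')

/-- Steps of `→ℓ` performed by a rule other than associativity or commutativity of `+`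
    (closed under the ξ and ξ_lin contexts). -/
inductive StepNAl : Term R → Term R → Prop
  | factor (a b : R) (M : Term R) : StepNAl (add (smul a M) (smul b M)) (smul (a + b) M)
  | factor1 (a : R) (M : Term R) : StepNAl (add (smul a M) M) (smul (a + 1) M)
  | factor11 (M : Term R) : StepNAl (add M M) (smul (1 + 1) M)
  | mulMul (a b : R) (M : Term R) : StepNAl (smul a (smul b M)) (smul (a * b) M)
  | mulDist (a : R) (M N : Term R) : StepNAl (smul a (add M N)) (add (smul a M) (smul a N))
  | oneSmul (M : Term R) : StepNAl (smul 1 M) M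
  | zeroSmul (M : Term R) : StepNAl (smul 0 M) zero
  | smulZero (a : R) : StepNAl (smul a zero) zero
  | zeroAdd (M : Term R) : StepNAl (add zero M) M
  | appAddV {V : Term R} (M N : Term R) : IsValue V →
      StepNAl (app (add M N) V) (add (app M V) (app N V))
  | appSmulV {V : Term R} (a : R) (M : Term R) : IsValue V →
      StepNAl (app (smul a M) V) (smul a (app M V))
  | appZeroV {V : Term R} : IsValue V → StepNAl (app zero V) zero
  | appAddB {B : Term R} (M N : Term R) : IsBase B →
      StepNAl (app B (add M N)) (add (app B M) (app B N))
  | appSmulB {B : Term R} (a : R) (M : Term R) : IsBase B →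
      StepNAl (app B (smul a M)) (smul a (app B M))
  | appZeroB {B : Term R} : IsBase B → StepNAl (app B zero) zero
  | ctxAppL {M M' : Term R} (N : Term R) : StepNAl M M' → StepNAl (app M N) (app M' N)
  | ctxAddL {M M' : Term R} (N : Term R) : StepNAl M M' → StepNAl (add M N) (add M' N)
  | ctxAddR {N N' : Term R} (M : Term R) : StepNAl N N' → StepNAl (add M N) (add M N')
  | ctxSmul (a : R) {M M' : Term R} : StepNAl M M' → StepNAl (smul a M) (smul a M')
  | ctxAppR {V M M' : Term R} : IsValue V → StepNAl M M' → StepNAl (app V M) (app V M')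

end NonAC

/-- The call-by-value-to-call-by-name encoding `M ↦ M~`.
    The fresh variables `f`, `g`, `h` are handled by de Bruijn lifting. -/
def cbvEnc : Term R → Term R
  | var n => lam (app (var 0) (var (n + 1)))
  | zero => zero
  | lam M => lam (app (var 0) (lift 0 (lam (cbvEnc M))))
  | app M N =>
      lam (app (lift 0 (cbvEnc M))
        (lam (app (lift 0 (lift 0 (cbvEnc N)))
          (lam (app (app (var 1) (var 0)) (var 2))))))
  | smul a M => lam (app (smul a (lift 0 (cbvEnc M))) (var 0))
  | add M N => lam (app (add (lift 0 (cbvEnc M)) (lift 0 (cbvEnc N))) (var 0))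

/-- The value encoding `Ψ` (its value on non-values is irrelevant). -/
def psi : Term R → Term R
  | var n => var n
  | zero => zero
  | lam M => lam (cbvEnc M)
  | smul a V => smul a (psi V)
  | add V W => add (psi V) (psi W)
  | app M N => app (psi M) (psi N)

/-- The call-by-name-to-call-by-value encoding `M ↦ ⟦M⟧`. -/
def cbnEnc : Term R → Term R
  | var n => var n
  | zero => lam (app zero (var 0))
  | lam M => lam (app (var 0) (lift 0 (lam (cbnEnc M))))
  | app M N =>
      lam (app (lift 0 (cbnEnc M))
        (lam (app (app (var 0) (lift 0 (lift 0 (cbnEnc N)))) (var 1))))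
  | smul a M => lam (app (smul a (lift 0 (cbnEnc M))) (var 0))
  | add M N => lam (app (add (lift 0 (cbnEnc M)) (lift 0 (cbnEnc N))) (var 0))

/-- The value encoding `Φ` (its value on non-values is irrelevant). -/
def phi : Term R → Term R
  | var n => app (var n) (lam (var 0))
  | zero => zero
  | lam M => lam (cbnEnc M)
  | smul a V => smul a (phi V)
  | add V W => add (phi V) (phi W)
  | app M N => app (phi M) (phi N)

/-- A measure on terms used to define the administrative operation `(:)`. -/
def size : Term R → ℕ
  | var _ => 1
  | lam _ => 1
  | zero => 1
  | smul _ M => 1 + size M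
  | add M N => 1 + size M + size N
  | app M N => size M * (size N + 1)

theorem size_pos : ∀ M : Term R, 0 < size M
  | var _ => Nat.one_pos
  | lam _ => Nat.one_pos
  | zero => Nat.one_pos
  | smul _ M => by simp [size]
  | add M N => by simp [size]
  | app M N => Nat.mul_pos (size_pos M) (Nat.succ_pos _)

/-- The administrative infix operation `(:)` of the call-by-value to call-by-name
    simulation: `colon M K` is `M : K`. -/
def colon : Term R → Term R → Term R
  | zero, _ => zero
  | var n, K => app K (var n)
  | lam M, K => app K (lam (cbvEnc M))
  | smul a M, K => smul a (colon M K)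
  | add M N, K => add (colon M K) (colon N K)
  | app zero _, _ => zero
  | app (var n) N, K =>
      colon N (lam (app (app (var (n + 1)) (var 0)) (lift 0 K)))
  | app (lam M) N, K =>
      colon N (lam (app (app (lift 0 (lam (cbvEnc M))) (var 0)) (lift 0 K)))
  | app (smul a M) N, K => smul a (colon (app M N) K)
  | app (add M M') N, K => add (colon (app M N) K) (colon (app M' N) K)
  | app (app M M') L, K =>
      colon (app M M')
        (lam (app (lift 0 (cbvEnc L))
          (lam (app (app (var 1) (var 0)) (lift 0 (lift 0 K))))))
termination_by M _ => size M
decreasing_by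
  all_goals simp only [size]
  · omega
  · omega
  · omega
  · nlinarith [size_pos N]
  · nlinarith [size_pos N]
  · nlinarith [size_pos M, size_pos N]
  · nlinarith [size_pos M, size_pos M', size_pos N]
  · nlinarith [size_pos M, size_pos M', size_pos N]
  · nlinarith [size_pos L, Nat.mul_pos (size_pos M) (Nat.succ_pos (size M'))]



section Equalities

variable [CommRing R]

/-- The restricted algebraic equality `=ℓ^F` on a fragment `F`. -/
def EqL (F : Set (Term R)) (M N : Term R) : Prop :=
  M ∈ F ∧ N ∈ F ∧ (StepL M N ∨ StepL N M)

/-- The relation `=ℓ∪β^F` : restricted algebraic equality together with `→βv` restricted to `F`. -/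
def EqLB (F : Set (Term R)) (M N : Term R) : Prop :=
  EqL F M N ∨ (M ∈ F ∧ N ∈ F ∧ StepBv M N)

/-- The restricted algebraic equality `=a^F` on a fragment `F`. -/
def EqA (F : Set (Term R)) (M N : Term R) : Prop :=
  M ∈ F ∧ N ∈ F ∧ (StepA M N ∨ StepA N M)

/-- The relation `=a∪β^F` : restricted algebraic equality together with `→βn` restricted to `F`. -/
def EqAB (F : Set (Term R)) (M N : Term R) : Prop :=
  EqA F M N ∨ (M ∈ F ∧ N ∈ F ∧ StepBn M N)

/-- The unrestricted algebraic equality `=ℓ` (symmetric closure of `→ℓ`). -/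
def EqLfull (M N : Term R) : Prop := StepL M N ∨ StepL N M

/-- The unrestricted relation `=ℓ∪β`. -/
def EqLBfull (M N : Term R) : Prop := EqLfull M N ∨ StepBv M N

/-- The unrestricted algebraic equality `=a` (symmetric closure of `→a`). -/
def EqAfull (M N : Term R) : Prop := StepA M N ∨ StepA N M

/-- The unrestricted relation `=a∪β`. -/
def EqABfull (M N : Term R) : Prop := EqAfull M N ∨ StepBn M N

end Equalities

/-- A weight on terms that bounds the number of non-AC steps of `→a`. -/
def weight : Term R → ℕ
  | var _ => 1
  | lam _ => 1
  | zero => 1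
  | smul _ M => 2 * weight M
  | add M N => weight M + weight N + 1
  | app M _ => weight M * weight M + weight M

theorem weight_pos (M : Term R) : 0 < weight M := by
  induction M <;> simp_all [weight]

theorem StepACa.weight_eq {M N : Term R} (h : StepACa M N) : weight M = weight N := by
  induction h <;> simp only [weight] <;> first | omega | simp_all

section WeightBound

variable [CommRing R]

theorem StepNAa.weight_lt {M N : Term R} (h : StepNAa M N) : weight N < weight M := by
  induction h with
  | factor a b M => simp only [weight]; omega
  | factor1 a M => simp only [weight]; omega
  | factor11 M => simp only [weight]; omega
  | mulMul a b M => have := weight_pos M; simp only [weight]; omega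
  | mulDist a M N => simp only [weight]; omega
  | oneSmul M => have := weight_pos M; simp only [weight]; omega
  | zeroSmul M => have := weight_pos M; simp only [weight]; omega
  | smulZero a => simp only [weight]; omega
  | zeroAdd M => simp only [weight]; omega
  | appAdd M N L =>
    have := weight_pos M
    simp only [weight]
    nlinarith [Nat.zero_le (weight M * weight N)]
  | appSmul a M N => have := weight_pos M; simp only [weight]; nlinarith
  | appZero M => simp only [weight]; omega
  | ctxAppL N _ ih => simp only [weight]; nlinarith
  | ctxAddL N _ ih => simp only [weight]; omega
  | ctxAddR M _ ih => simp only [weight]; omega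
  | ctxSmul a _ ih => simp only [weight]; omega

theorem card_nonAC_add_weight_le (f : ℕ → Term R) (ac : ℕ → Bool) (k : ℕ)
    (h : ∀ i < k,
      (ac i = true ∧ StepACa (f i) (f (i + 1))) ∨
      (ac i = false ∧ StepNAa (f i) (f (i + 1)))) :
    ((Finset.range k).filter (fun i => ac i = false)).card + weight (f k) ≤ weight (f 0) := by
  induction k with
  | zero => simp
  | succ k ih =>
    have hle := ih fun i hi => h i (by omega)
    rw [Finset.range_add_one, Finset.filter_insert]
    rcases h k (by omega) with ⟨hk, hs⟩ | ⟨hk, hs⟩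
    · rw [if_neg (by simp [hk]), ← hs.weight_eq]
      exact hle
    · have := hs.weight_lt
      rw [if_pos hk, Finset.card_insert_of_notMem (by simp)]
      omega

end WeightBound

section Statements

variable [CommRing R]

/-- `→a` is AC-strongly-normalising: for every term `M` there is `n : ℕ`
bounding, for every `→a`-rewrite sequence starting from `M` (each step labelled by
whether it is performed by an associativity/commutativity rule or by another rule),
the number of steps performed by a rule other than associativity or commutativity. -/
theorem ac_strongly_normalising_a (M : Term R) :
    ∃ n : ℕ, ∀ (k : ℕ) (f : ℕ → Term R) (ac : ℕ → Bool),
      f 0 = M →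
      (∀ i < k,
        (ac i = true ∧ StepACa (f i) (f (i + 1))) ∨
        (ac i = false ∧ StepNAa (f i) (f (i + 1)))) →
      ((Finset.range k).filter (fun i => ac i = false)).card ≤ n := by
  refine ⟨weight M, fun k f ac hf h => ?_⟩
  have := card_nonAC_add_weight_le f ac k h
  rw [hf] at this
  omega

end Statements

end Term

end AlgLam
end

section
/- Let S be a confluent fragment of the call-by-value algebraic λ-calculus with algebraic reduction. For every term M ∈ S and every value V, if M (=ℓ∪β^S)* V, then there exists a value V' such that M →ℓ∪β* V' and V (=ℓ^S)* V'. (Here R* denotes the reflexive-transitive closure of a relation R.) -/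
namespace AlgLam

namespace Term

variable {R : Type u}

section Statements

variable [CommRing R]

/-- Values only reduce by algebraic steps, and to values. -/
theorem IsValue.stepL_of_stepLB {V N : Term R} (hV : IsValue V) (h : StepLB V N) :
    StepL V N ∧ IsValue N := by
  induction hV generalizing N with
  | zero => rcases h with h | h <;> cases h
  | base hB => cases hB <;> rcases h with h | h <;> cases h
  | smul a hV ih =>
    rcases h with h | h
    · refine ⟨h, ?_⟩
      cases h with
      | mulMul =>
        cases hV with
        | base hB => cases hB
        | smul _ hV => exact .smul _ hV
      | mulDist =>
        cases hV with
        | base hB => cases hB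
        | add hV₁ hV₂ => exact .add (.smul a hV₁) (.smul a hV₂)
      | oneSmul => exact hV
      | zeroSmul | smulZero => exact .zero
      | ctxSmul _ h => exact .smul _ (ih (.inl h)).2
    · cases h with
      | ctxSmul _ h =>
        obtain ⟨hL, hN⟩ := ih (.inr h)
        exact ⟨.ctxSmul _ hL, .smul _ hN⟩
  | add hV hW ihV ihW =>
    rcases h with h | h
    · refine ⟨h, ?_⟩
      cases h with
      | assocL =>
        cases hW with
        | base hB => cases hB
        | add hW₁ hW₂ => exact .add (.add hV hW₁) hW₂
      | assocR =>
        cases hV with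
        | base hB => cases hB
        | add hV₁ hV₂ => exact .add hV₁ (.add hV₂ hW)
      | comm => exact .add hW hV
      | factor | factor1 =>
        cases hV with
        | base hB => cases hB
        | smul _ hV => exact .smul _ hV
      | factor11 => exact .smul _ hV
      | zeroAdd => exact hW
      | ctxAddL _ h => exact .add (ihV (.inl h)).2 hW
      | ctxAddR _ h => exact .add hV (ihW (.inl h)).2
    · cases h with
      | ctxAddL _ h =>
        obtain ⟨hL, hN⟩ := ihV (.inr h)
        exact ⟨.ctxAddL _ hL, .add hN hW⟩
      | ctxAddR _ h =>
        obtain ⟨hL, hN⟩ := ihW (.inr h)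
        exact ⟨.ctxAddR _ hL, .add hV hN⟩

/-- In a fragment, every reduct of a value is a value algebraically equal to it. -/
theorem IsValue.eqL_of_reduces {F : Set (Term R)}
    (hclosed : ∀ M ∈ F, ∀ N, StepLB M N → N ∈ F) {V N : Term R} (hF : V ∈ F)
    (hV : IsValue V) (h : Relation.ReflTransGen StepLB V N) :
    IsValue N ∧ Relation.ReflTransGen (EqL F) V N := by
  induction h using Relation.ReflTransGen.head_induction_on with
  | refl => exact ⟨hV, .refl⟩
  | head hstep _ ih =>
    obtain ⟨hL, hN⟩ := hV.stepL_of_stepLB hstep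
    have hF' := hclosed _ hF _ hstep
    obtain ⟨hN', hEq⟩ := ih hF' hN
    exact ⟨hN', .head ⟨hF, hF', .inl hL⟩ hEq⟩

theorem EqLB.mem_right {F : Set (Term R)} {M N : Term R} (h : EqLB F M N) : N ∈ F :=
  h.elim (fun h => h.2.1) fun h => h.2.1

/-- The Church–Rosser property of a confluent fragment. -/
theorem joinable_of_eqLB {F : Set (Term R)}
    (hconf : ∀ M ∈ F, ∀ N₁ N₂, Relation.ReflTransGen StepLB M N₁ →
      Relation.ReflTransGen StepLB M N₂ →
      ∃ L, Relation.ReflTransGen StepLB N₁ L ∧ Relation.ReflTransGen StepLB N₂ L)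
    {M N : Term R} (h : Relation.ReflTransGen (EqLB F) M N) :
    ∃ L, Relation.ReflTransGen StepLB M L ∧ Relation.ReflTransGen StepLB N L := by
  induction h with
  | refl => exact ⟨M, .refl, .refl⟩
  | tail _ hstep ih =>
    obtain ⟨L, hML, hNL⟩ := ih
    have forward {N P : Term R} (hN : N ∈ F) (hNL : Relation.ReflTransGen StepLB N L)
        (hNP : StepLB N P) : ∃ L', Relation.ReflTransGen StepLB M L' ∧
          Relation.ReflTransGen StepLB P L' := by
      obtain ⟨L', hLL', hPL'⟩ := hconf N hN L P hNL (.single hNP)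
      exact ⟨L', hML.trans hLL', hPL'⟩
    rcases hstep with ⟨hN, _, hNP | hPN⟩ | ⟨hN, _, hNP⟩
    · exact forward hN hNL (.inl hNP)
    · exact ⟨L, hML, .head (.inl hPN) hNL⟩
    · exact forward hN hNL (.inr hNP)

/-- in a confluent fragment `F` of the call-by-value calculus with
algebraic reduction, if `M (=ℓ∪β^F)* V` with `V` a value, then `M →ℓ∪β* V'` for
some value `V'` with `V (=ℓ^F)* V'`. -/
theorem eq_to_red_cbv (F : Set (Term R))
    (hclosed : ∀ M ∈ F, ∀ N, StepLB M N → N ∈ F)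
    (hconf : ∀ M ∈ F, ∀ N₁ N₂, Relation.ReflTransGen StepLB M N₁ →
      Relation.ReflTransGen StepLB M N₂ →
      ∃ L, Relation.ReflTransGen StepLB N₁ L ∧ Relation.ReflTransGen StepLB N₂ L)
    (M V : Term R) (hM : M ∈ F) (hV : IsValue V)
    (h : Relation.ReflTransGen (EqLB F) M V) :
    ∃ V', IsValue V' ∧ Relation.ReflTransGen StepLB M V' ∧
      Relation.ReflTransGen (EqL F) V V' := by
  obtain ⟨L, hML, hVL⟩ := joinable_of_eqLB hconf h
  have hVF : V ∈ F := by
    rcases h.cases_tail with rfl | ⟨_, _, hstep⟩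
    · exact hM
    · exact hstep.mem_right
  obtain ⟨hL, hEq⟩ := hV.eqL_of_reduces hclosed hVF hVL
  exact ⟨L, hL, hML, hEq⟩

end Statements

end Term

end AlgLam
end

section
/- Let T be a confluent fragment of the call-by-name algebraic λ-calculus with algebraic reduction. For every term M ∈ T and every value V, if M (=a∪β^T)* V, then there exists a value V' such that M →a∪β* V' and V (=a^T)* V'. (Here R* denotes the reflexive-transitive closure of a relation R.) -/
namespace AlgLam

namespace Term

variable {R : Type u}

theorem IsValue.of_smul {a : R} {V : Term R} (h : IsValue (Term.smul a V)) : IsValue V := by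
  cases h with
  | base hB => cases hB
  | smul _ h => exact h

theorem IsValue.of_add {V W : Term R} (h : IsValue (Term.add V W)) : IsValue V ∧ IsValue W := by
  cases h with
  | base hB => cases hB
  | add hV hW => exact ⟨hV, hW⟩

theorem not_isValue_app (M N : Term R) : ¬ IsValue (app M N) := by
  intro h
  cases h with
  | base hB => cases hB

theorem StepBn.not_isValue {V W : Term R} (h : StepBn V W) : ¬ IsValue V := by
  induction h with
  | beta => exact not_isValue_app _ _
  | ctxAppL => exact not_isValue_app _ _
  | ctxAddL _ _ ih => exact fun hV => ih hV.of_add.1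
  | ctxAddR _ _ ih => exact fun hV => ih hV.of_add.2
  | ctxSmul _ _ ih => exact fun hV => ih hV.of_smul

section Statements

variable [CommRing R]

theorem StepA.isValue {V W : Term R} (h : StepA V W) (hV : IsValue V) : IsValue W := by
  induction h with
  | assocL => exact .add (.add hV.of_add.1 hV.of_add.2.of_add.1) hV.of_add.2.of_add.2
  | assocR => exact .add hV.of_add.1.of_add.1 (.add hV.of_add.1.of_add.2 hV.of_add.2)
  | comm => exact .add hV.of_add.2 hV.of_add.1
  | factor => exact .smul _ hV.of_add.1.of_smul
  | factor1 => exact .smul _ hV.of_add.2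
  | factor11 => exact .smul _ hV.of_add.1
  | mulMul => exact .smul _ hV.of_smul.of_smul
  | mulDist => exact .add (.smul _ hV.of_smul.of_add.1) (.smul _ hV.of_smul.of_add.2)
  | oneSmul => exact hV.of_smul
  | zeroSmul => exact .zero
  | smulZero => exact .zero
  | zeroAdd => exact hV.of_add.2
  | appAdd => exact (not_isValue_app _ _ hV).elim
  | appSmul => exact (not_isValue_app _ _ hV).elim
  | appZero => exact .zero
  | ctxAppL => exact (not_isValue_app _ _ hV).elim
  | ctxAddL _ _ ih => exact .add (ih hV.of_add.1) hV.of_add.2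
  | ctxAddR _ _ ih => exact .add hV.of_add.1 (ih hV.of_add.2)
  | ctxSmul _ _ ih => exact .smul _ (ih hV.of_smul)

theorem mem_of_reflTransGen_stepAB {T : Set (Term R)}
    (hclosed : ∀ M ∈ T, ∀ N, StepAB M N → N ∈ T) {M N : Term R} (hM : M ∈ T)
    (h : Relation.ReflTransGen StepAB M N) : N ∈ T := by
  induction h with
  | refl => exact hM
  | tail _ hs ih => exact hclosed _ ih _ hs

/-- Values only reduce to values, using algebraic steps alone. -/
theorem IsValue.reflTransGen_stepAB {T : Set (Term R)}
    (hclosed : ∀ M ∈ T, ∀ N, StepAB M N → N ∈ T) {V W : Term R} (hT : V ∈ T)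
    (hV : IsValue V) (h : Relation.ReflTransGen StepAB V W) :
    IsValue W ∧ Relation.ReflTransGen (EqA T) V W := by
  induction h with
  | refl => exact ⟨hV, .refl⟩
  | tail hr hs ih =>
    have hmem := mem_of_reflTransGen_stepAB hclosed hT hr
    rcases hs with hA | hB
    · exact ⟨hA.isValue ih.1, ih.2.tail ⟨hmem, hclosed _ hmem _ (.inl hA), .inl hA⟩⟩
    · exact (hB.not_isValue ih.1).elim

/-- in a confluent fragment `T` of the call-by-name calculus with
algebraic reduction, if `M (=a∪β^T)* V` with `V` a value, then `M →a∪β* V'` for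
some value `V'` with `V (=a^T)* V'`. -/
theorem eq_to_red_cbn (T : Set (Term R))
    (hclosed : ∀ M ∈ T, ∀ N, StepAB M N → N ∈ T)
    (hconf : ∀ M ∈ T, ∀ N₁ N₂, Relation.ReflTransGen StepAB M N₁ →
      Relation.ReflTransGen StepAB M N₂ →
      ∃ L, Relation.ReflTransGen StepAB N₁ L ∧ Relation.ReflTransGen StepAB N₂ L)
    (M V : Term R) (hM : M ∈ T) (hV : IsValue V)
    (h : Relation.ReflTransGen (EqAB T) M V) :
    ∃ V', IsValue V' ∧ Relation.ReflTransGen StepAB M V' ∧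
      Relation.ReflTransGen (EqA T) V V' := by
  clear hM
  induction h using Relation.ReflTransGen.head_induction_on with
  | refl => exact ⟨V, hV, .refl, .refl⟩
  | head hs _ ih =>
    obtain ⟨V', hV', hred, heq⟩ := ih
    rcases hs with ⟨_, hN, hA | hA⟩ | ⟨_, _, hB⟩
    · exact ⟨V', hV', hred.head (.inl hA), heq⟩
    · obtain ⟨L, hL, hL'⟩ := hconf _ hN _ _ (.single (.inl hA)) hred
      obtain ⟨hLV, hLeq⟩ :=
        hV'.reflTransGen_stepAB hclosed (mem_of_reflTransGen_stepAB hclosed hN hred) hL'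
      exact ⟨L, hLV, hL, heq.trans hLeq⟩
    · exact ⟨V', hV', hred.head (.inr hB), heq⟩

end Statements

end Term

end AlgLam
end

section
/- For every term M of the algebraic λ-calculus, every base term B, and every variable x, the call-by-value-to-call-by-name encoding commutes with substitution: (M[x:=B])~ = M~[x:=Ψ(B)], where M[x:=N] denotes capture-avoiding substitution. -/
namespace AlgLam

namespace Term

variable {R : Type u}

theorem lift_lift_of_le (M : Term R) {c d : ℕ} (h : c ≤ d) :
    lift (d + 1) (lift c M) = lift c (lift d M) := by
  induction M generalizing c d with
  | var n =>
    simp only [lift]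
    split_ifs <;> simp only [lift] <;> split_ifs <;> first | rfl | omega
  | lam M ih => simp only [lift, ih (Nat.succ_le_succ h)]
  | zero => rfl
  | app M N ihM ihN => simp only [lift, ihM h, ihN h]
  | smul a M ih => simp only [lift, ih h]
  | add M N ihM ihN => simp only [lift, ihM h, ihN h]

theorem subst_lift_of_le (M N : Term R) {c d : ℕ} (h : c ≤ d) :
    subst (d + 1) (lift c N) (lift c M) = lift c (subst d N M) := by
  induction M generalizing N c d with
  | var n =>
    rcases lt_trichotomy n d with hn | rfl | hn
    · by_cases hc : n < c
      · simp [lift, subst, hn, hc, hn.trans (Nat.lt_succ_self d)]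
      · simp [lift, subst, hn, hc]
    · simp [lift, subst, not_lt.2 h]
    · have hc : ¬ n < c := by omega
      have hc' : ¬ n - 1 < c := by omega
      have hd : ¬ n < d := by omega
      have hd' : n ≠ d := by omega
      simp only [lift, subst, hc, hc', hd, hd', if_false, Nat.add_lt_add_iff_right,
        Nat.add_right_cancel_iff, var.injEq]
      omega
  | lam M ih =>
    simp only [lift, subst, ← lift_lift_of_le N (Nat.zero_le c),
      ih (lift 0 N) (Nat.succ_le_succ h)]
  | zero => rfl
  | app M L ihM ihL => simp only [lift, subst, ihM N h, ihL N h]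
  | smul a M ih => simp only [lift, subst, ih N h]
  | add M L ihM ihL => simp only [lift, subst, ihM N h, ihL N h]

theorem cbvEnc_lift (M : Term R) (d : ℕ) : cbvEnc (lift d M) = lift d (cbvEnc M) := by
  induction M generalizing d with
  | var n => by_cases h : n < d <;> simp [lift, cbvEnc, h]
  | lam M ih => simp [lift, cbvEnc, ih, lift_lift_of_le]
  | zero => rfl
  | app M N ihM ihN => simp [lift, cbvEnc, ihM, ihN, lift_lift_of_le]
  | smul a M ih => simp [lift, cbvEnc, ih, lift_lift_of_le]
  | add M N ihM ihN => simp [lift, cbvEnc, ihM, ihN, lift_lift_of_le]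

theorem psi_lift (M : Term R) (d : ℕ) : psi (lift d M) = lift d (psi M) := by
  induction M with
  | var n => by_cases h : n < d <;> simp [lift, psi, h]
  | lam M => simp only [lift, psi, cbvEnc_lift]
  | zero => rfl
  | app M N ihM ihN => simp only [lift, psi, ihM, ihN]
  | smul a M ih => simp only [lift, psi, ih]
  | add M N ihM ihN => simp only [lift, psi, ihM, ihN]

theorem IsBase.lift {B : Term R} (hB : IsBase B) (d : ℕ) : IsBase (lift d B) := by
  cases hB with
  | var n =>
    simp only [Term.lift]
    split_ifs <;> exact .var _
  | lam M => exact .lam _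

theorem IsBase.cbvEnc_eq {B : Term R} (hB : IsBase B) :
    cbvEnc B = Term.lam (app (Term.var 0) (Term.lift 0 (psi B))) := by
  cases hB <;> rfl

section Statements

variable [CommRing R]

/-- the call-by-value-to-call-by-name encoding commutes with
substitution of base terms: `(M[x:=B])~ = M~[x:=Ψ(B)]`. -/
theorem cbvEnc_subst (M B : Term R) (hB : IsBase B) (x : ℕ) :
    cbvEnc (subst x B M) = subst x (psi B) (cbvEnc M) := by
  induction M generalizing B x with
  | var n =>
    rcases lt_trichotomy n x with h | rfl | h
    · simp [subst, cbvEnc, h]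
    · simp [subst, cbvEnc, hB.cbvEnc_eq]
    · have hn : ¬ n < x := by omega
      have hn' : n ≠ x := by omega
      have hpos : n - 1 + 1 = n := by omega
      simp [subst, cbvEnc, hn, hn', hpos]
  | lam M ih =>
    simp [subst, cbvEnc, ih (lift 0 B) (hB.lift 0), psi_lift, lift, ← lift_lift_of_le,
      subst_lift_of_le]
  | zero => rfl
  | app M L ihM ihL => simp [subst, cbvEnc, ihM B hB, ihL B hB, subst_lift_of_le]
  | smul a M ih => simp [subst, cbvEnc, ih B hB, subst_lift_of_le]
  | add M L ihM ihL => simp [subst, cbvEnc, ihM B hB, ihL B hB, subst_lift_of_le]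

end Statements

end Term

end AlgLam
end

section
/- For every term M of the algebraic λ-calculus and every base term K, (M~) K →a∪β* M:K, where →a∪β* denotes the reflexive-transitive closure of →a∪β. -/
namespace AlgLam

namespace Term

variable {R : Type u}

theorem lift_lift_self (d : ℕ) (M : Term R) :
    lift d (lift d M) = lift (d + 1) (lift d M) := by
  induction M generalizing d with
  | var n =>
    by_cases h : n < d
    · simp [lift, h, Nat.lt_succ_of_lt h]
    · have h' : ¬ n + 1 < d := by omega
      simp [lift, h, h']
  | zero => rfl
  | _ => simp_all [lift]

theorem subst_lift (d : ℕ) (N M : Term R) : subst d N (lift d M) = M := by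
  induction M generalizing d N with
  | var n =>
    by_cases h : n < d
    · simp [lift, subst, h]
    · have h₁ : ¬ n + 1 < d := by omega
      have h₂ : n + 1 ≠ d := by omega
      simp [lift, subst, h, h₁, h₂]
  | zero => rfl
  | _ => simp_all [lift, subst]

theorem subst_one_lift_lift (N M : Term R) :
    subst 1 N (lift 0 (lift 0 M)) = lift 0 M := by
  rw [lift_lift_self, subst_lift]

section StepAB

variable [CommRing R]

open Relation

theorem StepAB.smul_congr (a : R) {M M' : Term R} (h : ReflTransGen StepAB M M') :
    ReflTransGen StepAB (smul a M) (smul a M') :=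
  h.lift (smul a) fun _ _ h => h.imp (StepA.ctxSmul a) (StepBn.ctxSmul a)

theorem StepAB.add_congr {M M' N N' : Term R} (hM : ReflTransGen StepAB M M')
    (hN : ReflTransGen StepAB N N') :
    ReflTransGen StepAB (add M N) (add M' N') :=
  (hM.lift (fun X => add X N) fun _ _ h =>
      h.imp (StepA.ctxAddL N) (StepBn.ctxAddL N)).trans
    (hN.lift (add M') fun _ _ h => h.imp (StepA.ctxAddR M') (StepBn.ctxAddR M'))

theorem StepAB.beta_of_eq {M N P : Term R} (h : subst 0 N M = P) :
    StepAB (app (lam M) N) P :=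
  h ▸ Or.inr (StepBn.beta M N)

/-- The continuation `λg.(L~) λh.((g) h) K`, which receives the value of the operator of an
application with argument `L`. -/
def argCont (L K : Term R) : Term R :=
  lam (app (lift 0 (cbvEnc L))
    (lam (app (app (var 1) (var 0)) (lift 0 (lift 0 K)))))

theorem argCont_app_step (L K V : Term R) :
    StepAB (app (argCont L K) V)
      (app (cbvEnc L) (lam (app (app (lift 0 V) (var 0)) (lift 0 K)))) :=
  StepAB.beta_of_eq (by simp [subst, subst_lift, subst_one_lift_lift])

theorem cbvEnc_app_step (M L K : Term R) :
    StepAB (app (cbvEnc (app M L)) K) (app (cbvEnc M) (argCont L K)) :=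
  StepAB.beta_of_eq (by simp [subst, subst_lift, subst_one_lift_lift, argCont])

theorem colon_argCont (M L K : Term R)
    (hL : ∀ K, ReflTransGen StepAB (app (cbvEnc L) K) (colon L K)) :
    ReflTransGen StepAB (colon M (argCont L K)) (colon (app M L) K) := by
  induction M with
  | var n =>
    simp only [colon]
    exact .head (argCont_app_step L K _) (hL _)
  | lam M =>
    simp only [colon]
    exact .head (argCont_app_step L K _) (hL _)
  | zero =>
    simp only [colon]
    exact .refl
  | smul a M ih =>
    simp only [colon]
    exact StepAB.smul_congr a ih
  | add M N ihM ihN =>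
    simp only [colon]
    exact StepAB.add_congr ihM ihN
  | app M N =>
    rw [colon.eq_def (app (app M N) L) K]
    exact .refl

/-- No assumption on the continuation is needed, because call-by-name `β` accepts any argument. -/
theorem reflTransGen_cbvEnc_app_colon (M K : Term R) :
    ReflTransGen StepAB (app (cbvEnc M) K) (colon M K) := by
  induction M generalizing K with
  | var n =>
    simp only [colon]
    exact .single (StepAB.beta_of_eq (by simp [subst]))
  | lam M =>
    simp only [colon]
    exact .single (StepAB.beta_of_eq (by rw [subst, subst_lift]; simp [subst]))
  | zero =>
    simp only [colon]
    exact .single (Or.inl (.appZero K))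
  | smul a M ih =>
    simp only [colon]
    have hβ : StepAB (app (cbvEnc (smul a M)) K) (app (smul a (cbvEnc M)) K) :=
      StepAB.beta_of_eq (by simp [subst, subst_lift])
    exact .head hβ (.head (Or.inl (.appSmul a _ K)) (StepAB.smul_congr a (ih K)))
  | add M N ihM ihN =>
    simp only [colon]
    have hβ : StepAB (app (cbvEnc (add M N)) K) (app (add (cbvEnc M) (cbvEnc N)) K) :=
      StepAB.beta_of_eq (by simp [subst, subst_lift])
    exact .head hβ (.head (Or.inl (.appAdd _ _ K)) (StepAB.add_congr (ihM K) (ihN K)))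
  | app M L ihM ihL =>
    exact .head (cbvEnc_app_step M L K) ((ihM _).trans (colon_argCont M L K ihL))

end StepAB

section Statements

variable [CommRing R]

/-- for every term `M` and base term `K`, `(M~) K →a∪β* M:K`. -/
theorem cbvEnc_app_colon (M K : Term R) (hK : IsBase K) :
    Relation.ReflTransGen StepAB (app (cbvEnc M) K) (colon M K) :=
  reflTransGen_cbvEnc_app_colon M K

end Statements

end Term

end AlgLam
end

section
/- For every value V of the algebraic λ-calculus, V:(λx.x) →a∪β* Ψ(V), where →a∪β* denotes the reflexive-transitive closure of →a∪β. -/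
namespace AlgLam

namespace Term

variable {R : Type u}

section Statements

variable [CommRing R]

theorem reflTransGen_stepAB_add {M M' N N' : Term R} (hM : Relation.ReflTransGen StepAB M M')
    (hN : Relation.ReflTransGen StepAB N N') :
    Relation.ReflTransGen StepAB (add M N) (add M' N') :=
  (hM.lift (add · N) fun _ _ h => h.imp (.ctxAddL N) (.ctxAddL N)).trans
    (hN.lift (add M') fun _ _ h => h.imp (.ctxAddR M') (.ctxAddR M'))

theorem reflTransGen_stepAB_smul (a : R) {M M' : Term R}
    (hM : Relation.ReflTransGen StepAB M M') :
    Relation.ReflTransGen StepAB (smul a M) (smul a M') :=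
  hM.lift (smul a) fun _ _ h => h.imp (.ctxSmul a) (.ctxSmul a)

theorem reflTransGen_stepAB_app_id (M : Term R) :
    Relation.ReflTransGen StepAB (app (lam (var 0)) M) M :=
  .single (.inr (by simpa [subst] using StepBn.beta (var 0) M))

/-- for every value `V`, `V:(λx.x) →a∪β* Ψ(V)`. -/
theorem colon_value (V : Term R) (hV : IsValue V) :
    Relation.ReflTransGen StepAB (colon V (lam (var 0))) (psi V) := by
  induction hV with
  | zero => simpa only [colon, psi] using .refl
  | base hB =>
    cases hB <;> simpa only [colon, psi] using reflTransGen_stepAB_app_id _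
  | smul a _ ih => simpa only [colon, psi] using reflTransGen_stepAB_smul a ih
  | add _ _ ihV ihW => simpa only [colon, psi] using reflTransGen_stepAB_add ihV ihW

end Statements

end Term

end AlgLam
end
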